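/- arXiv:math/9910191 — 10 statements merged into one kernel-verified Lean document; each statement's English description precedes it below -/
import Mathlib

section
/- Let x, y, z be integers with x ≥ 1, x + y odd, and x·y·(x^2+y^2-1) = z^3. Then z is even, y - x + 1 is even, and the integers m = (y-x+1)/2, k = x, l = z/2 satisfy ∑_{i=0}^{k-1} (m+i)^3 = l^3. -/
/-- Closed form for eight times a sum of `n` consecutive cubes starting at `m ^ 3`. -/
theorem eight_mul_sum_range_add_pow_three (m : ℤ) (n : ℕ) :
    8 * ∑ i ∈ Finset.range n, (m + (i : ℤ)) ^ 3 =
      n * (2 * m + n - 1) * ((n : ℤ) ^ 2 + (2 * m + n - 1) ^ 2 - 1) := by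
  induction n with
  | zero => simp
  | succ n ih =>
    rw [Finset.sum_range_succ, mul_add, ih]
    push_cast
    ring

/-- If `x ≥ 1`, `x + y` is odd and `x·y·(x²+y²-1) = z³`, then `z` and `y - x + 1` are even,
and `m = (y-x+1)/2`, `k = x`, `l = z/2` satisfy `∑_{i=0}^{k-1} (m+i)³ = l³`. -/
theorem stmt_1 (x y z : ℤ) (hx : 1 ≤ x) (hodd : Odd (x + y))
    (heq : x * y * (x ^ 2 + y ^ 2 - 1) = z ^ 3) :
    Even z ∧ Even (y - x + 1) ∧
      ∑ i ∈ Finset.range x.toNat, ((y - x + 1) / 2 + (i : ℤ)) ^ 3 = (z / 2) ^ 3 := by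
  have hz : Even z := by
    have hxy : Even (x * y) := by grind
    have h : Even (z ^ 3) := heq ▸ hxy.mul_right _
    exact (Int.even_pow.mp h).1
  have hm : Even (y - x + 1) := by grind
  refine ⟨hz, hm, ?_⟩
  obtain ⟨n, rfl⟩ := Int.eq_ofNat_of_zero_le (zero_le_one.trans hx)
  obtain ⟨l, rfl⟩ := even_iff_exists_two_mul.mp hz
  obtain ⟨m, hm⟩ := even_iff_exists_two_mul.mp hm
  obtain rfl : y = 2 * m + n - 1 := by linarith
  rw [hm, Int.mul_ediv_cancel_left _ two_ne_zero, Int.mul_ediv_cancel_left _ two_ne_zero,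
    Int.toNat_natCast]
  linarith [eight_mul_sum_range_add_pow_three m n, mul_pow 2 l 3]
end

section
/- Let F(x,y,z) = x·y·(x^2+y^2-1) - z^3 as a complex polynomial. The set of points (x,y,z) ∈ ℂ^3 at which F and all three partial derivatives ∂F/∂x = y(3x^2+y^2-1), ∂F/∂y = x(x^2+3y^2-1), ∂F/∂z = -3z^2 vanish simultaneously is exactly the five-element set {(0,0,0), (1,0,0), (-1,0,0), (0,1,0), (0,-1,0)}. -/
/-- The singular points of the affine surface `F(x,y,z) = x·y·(x²+y²-1) - z³ = 0`,
i.e. the common zeros of `F` and its three partial derivatives, are exactly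
`(0,0,0)`, `(±1,0,0)`, `(0,±1,0)`. -/
theorem stmt_3 :
    {p : ℂ × ℂ × ℂ |
        p.1 * p.2.1 * (p.1 ^ 2 + p.2.1 ^ 2 - 1) - p.2.2 ^ 3 = 0 ∧
        p.2.1 * (3 * p.1 ^ 2 + p.2.1 ^ 2 - 1) = 0 ∧
        p.1 * (p.1 ^ 2 + 3 * p.2.1 ^ 2 - 1) = 0 ∧
        -(3 * p.2.2 ^ 2) = 0} =
      {(0, 0, 0), (1, 0, 0), (-1, 0, 0), (0, 1, 0), (0, -1, 0)} := by
  ext ⟨x, y, z⟩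
  simp only [Set.mem_ofPred_eq, Set.mem_insert_iff, Set.mem_singleton_iff, Prod.mk.injEq]
  constructor
  · rintro ⟨hF, hx, hy, hz⟩
    obtain rfl : z = 0 := by simpa using hz
    by_cases hx0 : x = 0
    · subst hx0
      have h : y * ((y - 1) * (y + 1)) = 0 := by linear_combination hx
      rcases mul_eq_zero.mp h with h | h
      · simp [h]
      · rcases mul_eq_zero.mp h with h | h
        · simp [sub_eq_zero.mp h]
        · simp [eq_neg_of_add_eq_zero_left h]
    · have hy' : x ^ 2 + 3 * y ^ 2 - 1 = 0 := (mul_eq_zero.mp hy).resolve_left hx0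
      have hy3 : x * y ^ 3 = 0 := by linear_combination (x * y * hy' - hF) / 2
      obtain rfl : y = 0 := by simpa [hx0] using hy3
      have h : (x - 1) * (x + 1) = 0 := by linear_combination hy'
      rcases mul_eq_zero.mp h with h | h
      · simp [sub_eq_zero.mp h]
      · simp [eq_neg_of_add_eq_zero_left h]
  · rintro (⟨rfl, rfl, rfl⟩ | ⟨rfl, rfl, rfl⟩ | ⟨rfl, rfl, rfl⟩ | ⟨rfl, rfl, rfl⟩ | ⟨rfl, rfl, rfl⟩) <;>
      norm_num
end

section
/- Let K be a field and let t, x, z ∈ K with x ≠ 0 and t(t^2-1) ≠ 0. Set x₁ = (t^3-t)z/x and y₁ = (t^3-t)^2/x. Then x·t·(x^2+t^2-1) = z^3 holds if and only if y₁^2 = x₁^3 - t^4(t^2-1)^3. -/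
/-- For `x ≠ 0` and `t(t²-1) ≠ 0`, setting `x₁ = (t³-t)z/x` and `y₁ = (t³-t)²/x`,
the equation `x·t·(x²+t²-1) = z³` holds iff `y₁² = x₁³ - t⁴(t²-1)³`. -/
theorem stmt_4 (K : Type*) [Field K] (t x z : K) (hx : x ≠ 0)
    (ht : t * (t ^ 2 - 1) ≠ 0) :
    x * t * (x ^ 2 + t ^ 2 - 1) = z ^ 3 ↔
      ((t ^ 3 - t) ^ 2 / x) ^ 2 =
        ((t ^ 3 - t) * z / x) ^ 3 - t ^ 4 * (t ^ 2 - 1) ^ 3 := by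
  have hd : (t * (t ^ 2 - 1)) ^ 3 / x ^ 3 ≠ 0 := div_ne_zero (pow_ne_zero 3 ht) (pow_ne_zero 3 hx)
  have key : ((t ^ 3 - t) ^ 2 / x) ^ 2 -
      (((t ^ 3 - t) * z / x) ^ 3 - t ^ 4 * (t ^ 2 - 1) ^ 3) =
      (t * (t ^ 2 - 1)) ^ 3 / x ^ 3 * (x * t * (x ^ 2 + t ^ 2 - 1) - z ^ 3) := by
    rw [show t ^ 3 - t = t * (t ^ 2 - 1) by ring]
    field_simp
    ring
  rw [← sub_eq_zero, ← sub_eq_zero (a := (_ / x) ^ 2), key, mul_eq_zero, or_iff_right hd]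
end

section
/- Let u be a positive integer not divisible by 3. Then 6 divides (u-1)(u^3-2u^2-4u-4) and 6 divides u(u^2-1)(u^2+2), and the integers m = (u-1)(u^3-2u^2-4u-4)/6, k = u^3, l = u(u^2-1)(u^2+2)/6 satisfy ∑_{i=0}^{k-1} (m+i)^3 = l^3. -/
/-- Closed form for a sum of consecutive cubes. -/
theorem four_mul_sum_range_add_cube (m : ℤ) (k : ℕ) :
    4 * ∑ i ∈ Finset.range k, (m + (i : ℤ)) ^ 3 =
      ((m + k - 1) * (m + k)) ^ 2 - ((m - 1) * m) ^ 2 := by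
  induction k with
  | zero => simp
  | succ k ih =>
    rw [Finset.sum_range_succ, mul_add, ih]
    push_cast
    ring

/-- Pagliani's parametric family: for a positive integer `u` not divisible by `3`,
`m = (u-1)(u³-2u²-4u-4)/6`, `k = u³` and `l = u(u²-1)(u²+2)/6` are integers satisfying
`∑_{i=0}^{k-1} (m+i)³ = l³`. -/
theorem stmt_9 (u : ℕ) (hu : 0 < u) (h3 : ¬ (3 ∣ u)) :
    (6 : ℤ) ∣ ((u : ℤ) - 1) * ((u : ℤ) ^ 3 - 2 * (u : ℤ) ^ 2 - 4 * (u : ℤ) - 4) ∧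
    (6 : ℤ) ∣ (u : ℤ) * ((u : ℤ) ^ 2 - 1) * ((u : ℤ) ^ 2 + 2) ∧
    ∑ i ∈ Finset.range (u ^ 3),
        ((((u : ℤ) - 1) * ((u : ℤ) ^ 3 - 2 * (u : ℤ) ^ 2 - 4 * (u : ℤ) - 4)) / 6 + (i : ℤ)) ^ 3 =
      (((u : ℤ) * ((u : ℤ) ^ 2 - 1) * ((u : ℤ) ^ 2 + 2)) / 6) ^ 3 := by
  have hdvd : ∀ x : ℤ, x % 6 = 0 → (6 : ℤ) ∣ x := fun x => Int.dvd_of_emod_eq_zero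
  have hmod : (u : ℤ) % 6 = 1 ∨ (u : ℤ) % 6 = 2 ∨ (u : ℤ) % 6 = 4 ∨ (u : ℤ) % 6 = 5 := by
    omega
  have hm : (6 : ℤ) ∣ ((u : ℤ) - 1) * ((u : ℤ) ^ 3 - 2 * (u : ℤ) ^ 2 - 4 * (u : ℤ) - 4) := by
    apply hdvd
    rcases hmod with h | h | h | h <;> simp [Int.sub_emod, Int.mul_emod, pow_succ, h]
  have hl : (6 : ℤ) ∣ (u : ℤ) * ((u : ℤ) ^ 2 - 1) * ((u : ℤ) ^ 2 + 2) := by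
    apply hdvd
    rcases hmod with h | h | h | h <;>
      simp [Int.sub_emod, Int.add_emod, Int.mul_emod, pow_succ, h]
  refine ⟨hm, hl, ?_⟩
  obtain ⟨m, hm⟩ := hm
  obtain ⟨l, hl⟩ := hl
  rw [hm, hl, Int.mul_ediv_cancel_left _ (by norm_num), Int.mul_ediv_cancel_left _ (by norm_num)]
  have hsum := four_mul_sum_range_add_cube m (u ^ 3)
  push_cast at hsum
  have key : 1296 * (4 * ∑ i ∈ Finset.range (u ^ 3), (m + (i : ℤ)) ^ 3) = 24 * (6 * l) ^ 3 := by
    calc 1296 * (4 * ∑ i ∈ Finset.range (u ^ 3), (m + (i : ℤ)) ^ 3)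
        = ((6 * m + 6 * (u : ℤ) ^ 3 - 6) * (6 * m + 6 * (u : ℤ) ^ 3)) ^ 2
            - ((6 * m - 6) * (6 * m)) ^ 2 := by rw [hsum]; ring
      _ = 24 * (6 * l) ^ 3 := by rw [← hm, ← hl]; ring
  linarith
end

section
/- The set of triples (m, k, l) of positive integers with k ≥ 2 satisfying m^3 + (m+1)^3 + ... + (m+k-1)^3 = l^3 (i.e. ∑_{i=0}^{k-1}(m+i)^3 = l^3) is infinite. -/
theorem eight_mul_sum_range_add_cube (m k : ℕ) :
    8 * ∑ i ∈ Finset.range k, ((m : ℤ) + i) ^ 3 =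
      k * (2 * m + k - 1) * ((2 * m + k - 1) ^ 2 + k ^ 2 - 1) := by
  induction k with
  | zero => simp
  | succ k ih =>
    rw [Finset.sum_range_succ, mul_add, ih]
    push_cast
    ring

/-- Pagliani's family: for `v = 6 * n + 4`, a sum of `v ^ 3` consecutive cubes that is a cube. -/
theorem sum_range_add_cube_eq_cube (n : ℕ) :
    ∑ i ∈ Finset.range ((6 * n + 4) ^ 3),
        ((216 * n ^ 4 + 468 * n ^ 3 + 348 * n ^ 2 + 96 * n + 6) + i) ^ 3 =
      ((3 * n + 2) * (432 * n ^ 4 + 1152 * n ^ 3 + 1164 * n ^ 2 + 528 * n + 90)) ^ 3 := by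
  have h := eight_mul_sum_range_add_cube
    (216 * n ^ 4 + 468 * n ^ 3 + 348 * n ^ 2 + 96 * n + 6) ((6 * n + 4) ^ 3)
  zify
  refine mul_left_cancel₀ (show (8 : ℤ) ≠ 0 by norm_num) ?_
  push_cast at h
  rw [h]
  ring

/-- There are infinitely many triples `(m, k, l)` of positive integers with `k ≥ 2`
such that `m³ + (m+1)³ + ⋯ + (m+k-1)³ = l³`. -/
theorem stmt_10 :
    {p : ℕ × ℕ × ℕ | 0 < p.1 ∧ 2 ≤ p.2.1 ∧ 0 < p.2.2 ∧
        ∑ i ∈ Finset.range p.2.1, (p.1 + i) ^ 3 = p.2.2 ^ 3}.Infinite := by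
  refine Set.infinite_of_injective_forall_mem
    (f := fun n : ℕ => (216 * n ^ 4 + 468 * n ^ 3 + 348 * n ^ 2 + 96 * n + 6, (6 * n + 4) ^ 3,
      (3 * n + 2) * (432 * n ^ 4 + 1152 * n ^ 3 + 1164 * n ^ 2 + 528 * n + 90))) ?_ ?_
  · intro a b h
    have hk : (6 * a + 4) ^ 3 = (6 * b + 4) ^ 3 := congrArg (fun p => p.2.1) h
    have := Nat.pow_left_injective (by norm_num : (3 : ℕ) ≠ 0) hk
    omega
  · intro n
    refine ⟨by positivity, ?_, by positivity, sum_range_add_cube_eq_cube n⟩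
    calc 2 ≤ 6 * n + 4 := by omega
      _ ≤ (6 * n + 4) ^ 3 := Nat.le_self_pow (by norm_num) _
end

section
/- Let K be a field of characteristic 0 and t, x, y ∈ K with y^2 = x^3 - 432·t^2(t-1)^2(t+1)^2(t^2+1)^2. Define X' = -2(t^4+1)y - t·x^2 + 12t^3·x - 72t(t^4-1)^2, Y' = -2(2t^4-1)y + t·x^2 - 12t^3(t^4-1)x + 72t(t^4-1), Z' = t·(-2(t^4+1)y - t·x^2 + 12t^3·x - 72t(t^4-1)^2), W' = 2t(t^4-2)y + t^2·x^2 + 12(t^4-1)x - 72t^6(t^4-1). Then X'(X'^3 + Y'^3) = Z'(Z'^3 + W'^3). -/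
/-- The transformation from the Weierstrass model `y² = x³ - 432t²(t-1)²(t+1)²(t²+1)²`
back to the quartic surface `S' : X'(X'³+Y'³) = Z'(Z'³+W'³)`. -/
theorem stmt_11 (K : Type*) [Field K] [CharZero K] (t x y : K)
    (h : y ^ 2 = x ^ 3 - 432 * (t ^ 2 * (t - 1) ^ 2 * (t + 1) ^ 2 * (t ^ 2 + 1) ^ 2)) :
    let X' := -2 * (t ^ 4 + 1) * y - t * x ^ 2 + 12 * t ^ 3 * x - 72 * t * (t ^ 4 - 1) ^ 2
    let Y' := -2 * (2 * t ^ 4 - 1) * y + t * x ^ 2 - 12 * t ^ 3 * (t ^ 4 - 1) * x +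
      72 * t * (t ^ 4 - 1)
    let Z' := t * (-2 * (t ^ 4 + 1) * y - t * x ^ 2 + 12 * t ^ 3 * x - 72 * t * (t ^ 4 - 1) ^ 2)
    let W' := 2 * t * (t ^ 4 - 2) * y + t ^ 2 * x ^ 2 + 12 * (t ^ 4 - 1) * x -
      72 * t ^ 6 * (t ^ 4 - 1)
    X' * (X' ^ 3 + Y' ^ 3) = Z' * (Z' ^ 3 + W' ^ 3) := by
  intro X' Y' Z' W'
  have cubic : (1 - t ^ 4) * X' ^ 3 + Y' ^ 3 - t * W' ^ 3 = 0 := by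
    linear_combination
      ((1 - t ^ 4) * (-2 * (t ^ 4 + 1)) ^ 2 *
          (3 * (-t * x ^ 2 + 12 * t ^ 3 * x - 72 * t * (t ^ 4 - 1) ^ 2) - 2 * (t ^ 4 + 1) * y) +
        (-2 * (2 * t ^ 4 - 1)) ^ 2 *
          (3 * (t * x ^ 2 - 12 * t ^ 3 * (t ^ 4 - 1) * x + 72 * t * (t ^ 4 - 1)) -
            2 * (2 * t ^ 4 - 1) * y) -
        t * (2 * t * (t ^ 4 - 2)) ^ 2 *
          (3 * (t ^ 2 * x ^ 2 + 12 * (t ^ 4 - 1) * x - 72 * t ^ 6 * (t ^ 4 - 1)) +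
            2 * t * (t ^ 4 - 2) * y)) * h
  have hZ : Z' = t * X' := rfl
  rw [hZ]
  linear_combination X' * cubic
end

section
/- Let t, x, y ∈ ℂ with y^2 = x^3 - 432·t^2(t-1)^2(t+1)^2(t^2+1)^2. Let √3 denote the positive real square root of 3, i the imaginary unit, and √-3 = i√3. Define X = 72√3·t(t^2+1)^2, Y = 3y - 36√-3·t(t^4-1), Z = -6√-3·(t^2+1)x, W = -t(3i·y - 36√3·t(t^2+3)(t^2+1)). Then X·Y·(X^2+Y^2-W^2) = Z^3·W. -/
/-- The transformation from the Weierstrass model `y² = x³ - 432t²(t-1)²(t+1)²(t²+1)²`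
back to the quartic surface `S₀ : XY(X²+Y²-W²) = Z³W`. -/
theorem stmt_12 (t x y : ℂ)
    (h : y ^ 2 = x ^ 3 - 432 * (t ^ 2 * (t - 1) ^ 2 * (t + 1) ^ 2 * (t ^ 2 + 1) ^ 2)) :
    let s3 : ℂ := (Real.sqrt 3 : ℝ)
    let sm3 : ℂ := Complex.I * s3
    let X := 72 * s3 * t * (t ^ 2 + 1) ^ 2
    let Y := 3 * y - 36 * sm3 * t * (t ^ 4 - 1)
    let Z := -6 * sm3 * (t ^ 2 + 1) * x
    let W := -t * (3 * Complex.I * y - 36 * s3 * t * (t ^ 2 + 3) * (t ^ 2 + 1))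
    X * Y * (X ^ 2 + Y ^ 2 - W ^ 2) = Z ^ 3 * W := by
  intro s3 sm3 X Y Z W
  have hI : Complex.I ^ 2 = -1 := Complex.I_sq
  have hs : s3 ^ 2 = 3 := by
    simp only [s3]
    exact_mod_cast Real.sq_sqrt (by norm_num : (0 : ℝ) ≤ 3)
  have hsm : sm3 ^ 2 = -3 := by simp only [sm3, mul_pow, hI, hs]; norm_num
  have hW : W = t * (X - Complex.I * Y) := by
    simp only [W, X, Y, sm3]
    linear_combination 36 * t ^ 2 * s3 * (1 - t ^ 4) * hI
  have hQ : X + Complex.I * Y - t * W =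
      3 * Complex.I * (1 + t ^ 2) * (y + 12 * sm3 * t * (t ^ 4 - 1)) := by
    simp only [W, X, Y, sm3]
    linear_combination -36 * s3 * t * (t ^ 4 - 1) * (2 + t ^ 2) * hI
  have hYQ : Y * (X + Complex.I * Y - t * W) = 9 * Complex.I * (1 + t ^ 2) * x ^ 3 := by
    rw [hQ]
    simp only [Y]
    linear_combination 9 * Complex.I * (1 + t ^ 2) * h
      - 1296 * Complex.I * (1 + t ^ 2) * t ^ 2 * (t ^ 4 - 1) ^ 2 * hsm
  have hZ : t * Z ^ 3 = X * (9 * Complex.I * (1 + t ^ 2) * x ^ 3) := by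
    simp only [Z, X]
    have : sm3 ^ 3 = -3 * Complex.I * s3 := by rw [pow_succ, hsm]; simp only [sm3]; ring
    linear_combination -216 * t * (t ^ 2 + 1) ^ 3 * x ^ 3 * this
  have hF : X ^ 2 + Y ^ 2 - W ^ 2 =
      (X - Complex.I * Y) * (X + Complex.I * Y - t * W) := by
    linear_combination Y ^ 2 * hI - W * hW
  rw [hF]
  linear_combination (X * (X - Complex.I * Y)) * hYQ - (X - Complex.I * Y) * hZ - Z ^ 3 * hW
end

section
/- Let K be a field and u, s, x₀, y₀ ∈ K with s^2 = u^6 - 1, y₀^2 = x₀^3 - 1, and y₀ ≠ 0. Then x = s/y₀, y = u^3, z = u·s·x₀/y₀ satisfy x·y·(x^2+y^2-1) = z^3. -/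
/-- The map `ψ : C × E⁻ → S`: if `s² = u⁶ - 1`, `y₀² = x₀³ - 1` and `y₀ ≠ 0`, then
`x = s/y₀`, `y = u³`, `z = u·s·x₀/y₀` satisfy `x·y·(x²+y²-1) = z³`. -/
theorem stmt_13 (K : Type*) [Field K] (u s x₀ y₀ : K)
    (hs : s ^ 2 = u ^ 6 - 1) (hy : y₀ ^ 2 = x₀ ^ 3 - 1) (hy₀ : y₀ ≠ 0) :
    (s / y₀) * u ^ 3 * ((s / y₀) ^ 2 + (u ^ 3) ^ 2 - 1) = (u * s * x₀ / y₀) ^ 3 := by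
  have hu : (u ^ 3) ^ 2 = s ^ 2 + 1 := by linear_combination -hs
  have hx : x₀ ^ 3 = y₀ ^ 2 + 1 := by linear_combination -hy
  rw [hu, div_pow (u * s * x₀), mul_pow, hx]
  field_simp
  ring
end

section
/- Let p ≥ 5 be a prime with p ≡ 2 (mod 3), let n be an odd positive integer, and let F be a finite field with p^n elements. Then the number of triples (t,x,y) ∈ F^3 satisfying y^2 = x^3 - t^4(t^2-1)^3 equals p^{2n}. -/
theorem pow_six_mul_add_three_of_card_eq {F : Type*} [Field F] [Fintype F] {k : ℕ}
    (hk : Fintype.card F = 3 * k + 2) (a : F) : a ^ (6 * k + 3) = a := by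
  have h : a ^ (3 * k + 2) = a := hk ▸ FiniteField.pow_card a
  calc a ^ (6 * k + 3) = a ^ (3 * k + 2) * a ^ (3 * k + 1) := by ring
    _ = a * a ^ (3 * k + 1) := by rw [h]
    _ = a ^ (3 * k + 2) := by ring
    _ = a := h

/-- Cubing is a bijection of a finite field whose order is `2` modulo `3`. -/
theorem pow_three_bijective_of_card_mod_three {F : Type*} [Field F] [Fintype F]
    (hF : Fintype.card F % 3 = 2) : Function.Bijective fun x : F => x ^ 3 := by
  obtain ⟨k, hk⟩ : ∃ k, Fintype.card F = 3 * k + 2 := ⟨Fintype.card F / 3, by omega⟩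
  have key (a : F) : (a ^ 3) ^ (2 * k + 1) = a := by
    rw [← pow_mul, show 3 * (2 * k + 1) = 6 * k + 3 by ring]
    exact pow_six_mul_add_three_of_card_eq hk a
  refine Function.bijective_iff_has_inverse.2 ⟨fun x => x ^ (2 * k + 1), key, fun a => ?_⟩
  change (a ^ (2 * k + 1)) ^ 3 = a
  rw [pow_right_comm, key]

/-- If cubing is bijective on `F`, the surface `y² = x³ - f(t)` has `|F|²` points. -/
theorem card_sq_eq_pow_three_sub {F : Type*} [Field F]
    (hcube : Function.Bijective fun x : F => x ^ 3) (f : F → F) :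
    Nat.card {v : F × F × F // v.2.2 ^ 2 = v.2.1 ^ 3 - f v.1} = Nat.card F ^ 2 := by
  rw [sq, ← Nat.card_prod]
  refine Nat.card_eq_of_bijective (fun v => (v.1.1, v.1.2.2)) ⟨?_, ?_⟩
  · rintro ⟨⟨t, x, y⟩, h⟩ ⟨⟨t', x', y'⟩, h'⟩ he
    obtain ⟨rfl, rfl⟩ := Prod.mk.inj he
    have hx : x = x' := hcube.1 (sub_left_injective (h.symm.trans h'))
    subst hx
    rfl
  · rintro ⟨t, y⟩
    obtain ⟨x, hx⟩ := hcube.2 (y ^ 2 + f t)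
    exact ⟨⟨(t, x, y), eq_sub_of_add_eq hx.symm⟩, rfl⟩


/-- For a prime `p ≥ 5` with `p ≡ 2 (mod 3)` and odd `n`, the number of solutions
`(t,x,y) ∈ F³` of `y² = x³ - t⁴(t²-1)³` over a field `F` with `pⁿ` elements is `p^{2n}`. -/
theorem stmt_14 (p : ℕ) (hp : p.Prime) (hp5 : 5 ≤ p) (hp3 : p % 3 = 2)
    (n : ℕ) (hn : 0 < n) (hodd : Odd n)
    (F : Type*) [Field F] [Fintype F] (hF : Fintype.card F = p ^ n) :
    Nat.card {v : F × F × F //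
        v.2.2 ^ 2 = v.2.1 ^ 3 - v.1 ^ 4 * (v.1 ^ 2 - 1) ^ 3} = p ^ (2 * n) := by
  have hcard : Fintype.card F % 3 = 2 := by
    obtain ⟨m, rfl⟩ := hodd
    rw [hF, Nat.pow_mod, hp3, pow_succ, pow_mul, Nat.mul_mod, Nat.pow_mod]
    norm_num
  rw [card_sq_eq_pow_three_sub (pow_three_bijective_of_card_mod_three hcard)
      fun t => t ^ 4 * (t ^ 2 - 1) ^ 3,
    Nat.card_eq_fintype_card, hF, ← pow_mul, mul_comm]
end

section
/- Let p ≥ 5 be a prime with p ≡ 1 (mod 3), let n be a positive integer, and let F be a finite field with p^n elements. Let ω = (-1+√-3)/2 ∈ ℂ be a primitive cube root of unity. Suppose a, b are integers with p = a^2 - ab + b^2, and j ∈ {0,1,2} is such that a + bω - ω^j ∈ 2ℤ[ω] (i.e. there exist integers c, d with a + bω - ω^j = 2(c + dω)). Set α = (-1)^{(p-1)/2}·ω^j·(a+bω)^2 ∈ ℂ. Then the number N of triples (t,x,y) ∈ F^3 satisfying y^2 = x^3 - t^4(t^2-1)^3 satisfies, as an equality of complex numbers, N = p^{2n} + 2·p^n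 + α^n + conj(α)^n, where conj denotes complex conjugation. -/
/-- The Eisenstein integers, as the quadratic algebra with `ω ^ 2 = -1 - ω`. -/
abbrev Eisenstein : Type := QuadraticAlgebra ℤ (-1) (-1)

namespace Eisenstein

open QuadraticAlgebra

lemma norm_eq (z : Eisenstein) : z.norm = z.re ^ 2 - z.re * z.im + z.im ^ 2 := by
  rw [QuadraticAlgebra.norm_def]; ring

lemma mul_star_eq (z : Eisenstein) : z * star z = (z.norm : Eisenstein) :=
  (algebraMap_norm_eq_mul_star z).symm

lemma omega_pow_three : (omega : Eisenstein) ^ 3 = 1 := by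
  ext <;> simp [pow_succ]

lemma dvd_of_dvd_form {p : ℤ} (hp : Prime p) {π : Eisenstein} (hπ : π.norm = p)
    {z : Eisenstein} (h : p ∣ π.im * z.re - π.re * z.im) : π ∣ z := by
  rw [norm_eq] at hπ
  have hb : ¬ p ∣ π.im := by
    intro hb
    have ha : p ∣ π.re := by
      refine hp.dvd_of_dvd_pow (n := 2) ?_
      have : π.re ^ 2 = p + π.im * (π.re - π.im) := by linear_combination hπ
      rw [this]
      exact dvd_add dvd_rfl (hb.mul_right _)
    obtain ⟨x, hx⟩ := ha
    obtain ⟨y, hy⟩ := hb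
    refine hp.not_isUnit (IsUnit.of_mul_eq_one (x ^ 2 - x * y + y ^ 2) ?_)
    apply mul_left_cancel₀ hp.ne_zero
    rw [hx, hy] at hπ
    linear_combination hπ
  have h' : p ∣ π.re * z.re - π.im * z.re + π.im * z.im := by
    refine (hp.dvd_or_dvd (a := π.im) ?_).resolve_left hb
    have : π.im * (π.re * z.re - π.im * z.re + π.im * z.im) =
        (π.im * z.re - π.re * z.im) * (π.re - π.im) + p * z.im := by
      linear_combination z.im * hπ
    rw [this]
    exact dvd_add (h.mul_right _) (dvd_mul_right _ _)
  obtain ⟨k, hk⟩ := h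
  obtain ⟨l, hl⟩ := h'
  refine ⟨⟨l, -k⟩, ?_⟩
  ext
  · apply mul_left_cancel₀ hp.ne_zero
    rw [re_mul]
    linear_combination π.re * hl + π.im * hk - z.re * hπ
  · apply mul_left_cancel₀ hp.ne_zero
    rw [im_mul]
    linear_combination π.im * hl - (π.re - π.im) * hk - z.im * hπ

lemma dvd_or_star_dvd {p : ℤ} (hp : Prime p) {π : Eisenstein} (hπ : π.norm = p)
    {z : Eisenstein} (h : p ∣ z.norm) : π ∣ z ∨ star π ∣ z := by
  have hπ' : (star π).norm = p := by rw [QuadraticAlgebra.norm_star, hπ]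
  have key : p ∣ (π.im * z.re - π.re * z.im) *
      ((star π).im * z.re - (star π).re * z.im) := by
    have : (π.im * z.re - π.re * z.im) * ((star π).im * z.re - (star π).re * z.im) =
        p * z.im ^ 2 - z.norm * π.im ^ 2 := by
      rw [← hπ, norm_eq, norm_eq, re_star, im_star]
      ring
    rw [this]
    exact dvd_sub (dvd_mul_right _ _) (h.mul_right _)
  exact (hp.dvd_or_dvd key).imp (dvd_of_dvd_form hp hπ) (dvd_of_dvd_form hp hπ')

theorem exists_eq_unit_mul_pow {p : ℤ} (hp : Prime p) {π : Eisenstein} (hπ : π.norm = p)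
    (n : ℕ) (z : Eisenstein) (hz : z.norm = p ^ n) (hpz : ¬ (p : Eisenstein) ∣ z) :
    ∃ u : Eisenstein, u.norm = 1 ∧ (z = u * π ^ n ∨ z = u * star π ^ n) := by
  have hpπ : (p : Eisenstein) = π * star π := by rw [mul_star_eq, hπ]
  induction n generalizing z with
  | zero => exact ⟨z, by simpa using hz, by simp⟩
  | succ n ih =>
    have descent : ∀ ρ : Eisenstein, ρ.norm = p → ρ ∣ z →
        ∃ w : Eisenstein, z = ρ * w ∧ w.norm = p ^ n ∧ ¬ (p : Eisenstein) ∣ w := by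
      rintro ρ hρ ⟨w, rfl⟩
      refine ⟨w, rfl, ?_, fun h ↦ hpz (h.mul_left _)⟩
      apply mul_left_cancel₀ hp.ne_zero
      rw [map_mul, hρ] at hz
      rw [hz, pow_succ']
    have nodvd : ∀ ρ w u : Eisenstein, ρ * star ρ = p → z = ρ * w → w = u * star ρ ^ n →
        n = 0 := by
      intro ρ w u hρ hzw hw
      by_contra hn
      obtain ⟨m, rfl⟩ := Nat.exists_eq_succ_of_ne_zero hn
      exact hpz ⟨u * star ρ ^ m, by rw [hzw, hw, ← hρ, pow_succ]; ring⟩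
    have hpπ' : star π * star (star π) = p := by rw [star_star, hpπ, mul_comm]
    rcases dvd_or_star_dvd hp hπ (z := z) (by rw [hz, pow_succ']; exact dvd_mul_right _ _)
      with h | h
    · obtain ⟨w, hzw, hw, hpw⟩ := descent π hπ h
      obtain ⟨u, hu, h1 | h1⟩ := ih w hw hpw
      · exact ⟨u, hu, .inl (by rw [hzw, h1]; ring)⟩
      · obtain rfl := nodvd π w u hpπ.symm hzw h1
        exact ⟨u, hu, .inl (by rw [hzw, h1]; ring)⟩
    · obtain ⟨w, hzw, hw, hpw⟩ := descent (star π) (by rw [QuadraticAlgebra.norm_star, hπ]) h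
      obtain ⟨u, hu, h1 | h1⟩ := ih w hw hpw
      · obtain rfl := nodvd (star π) w u hpπ' hzw (by rw [h1, star_star])
        exact ⟨u, hu, .inr (by rw [hzw, h1]; ring)⟩
      · exact ⟨u, hu, .inr (by rw [hzw, h1]; ring)⟩

lemma sq_eq_one_of_norm_eq_one {u : Eisenstein} (hu : u.norm = 1) (h : 2 ∣ u - 1) :
    u ^ 2 = 1 := by
  obtain ⟨v, hv⟩ := h
  have him := congrArg QuadraticAlgebra.im hv
  simp at him
  rw [norm_eq] at hu
  have h0 : u.im = 0 := by
    have : 3 * v.im ^ 2 ≤ 1 := by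
      rw [him] at hu
      nlinarith [sq_nonneg (u.re - v.im)]
    have : v.im = 0 := by nlinarith
    rw [him, this, mul_zero]
  rw [h0] at hu
  ext
  · simp [pow_two, h0]
    linear_combination hu
  · simp [pow_two, h0]

/-- If `u` is a unit and `u * π ^ n` is `1` modulo `2`, then the square of `u * π ^ n` is determined
by `π` and its residue modulo `2`. -/
lemma sq_eq_of_eq_unit_mul_pow {z u π : Eisenstein} {j n : ℕ} (hu : u.norm = 1)
    (hz : z = u * π ^ n) (hz2 : 2 ∣ z - 1) (hπ2 : 2 ∣ π - omega ^ j) :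
    z ^ 2 = (omega ^ j * π ^ 2) ^ n := by
  have h1 : 2 ∣ u * (omega ^ j) ^ n - 1 := by
    have : u * (omega ^ j) ^ n - 1 = (z - 1) - u * (π ^ n - (omega ^ j) ^ n) := by
      rw [hz]; ring
    rw [this]
    exact dvd_sub hz2 ((hπ2.trans (sub_dvd_pow_sub_pow _ _ n)).mul_left u)
  have hω : (omega : Eisenstein).norm = 1 := by simp [norm_eq]
  have h2 := sq_eq_one_of_norm_eq_one (u := u * (omega ^ j) ^ n) (by simp [hu, hω]) h1
  have h3 : ((omega : Eisenstein) ^ j) ^ n * ((omega ^ j) ^ n) ^ 2 = 1 := by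
    calc _ = ((omega : Eisenstein) ^ 3) ^ (j * n) := by ring
      _ = 1 := by rw [omega_pow_three, one_pow]
  rw [hz]
  calc (u * π ^ n) ^ 2 = u ^ 2 * (π ^ 2) ^ n := by ring
    _ = (u ^ 2 * (((omega : Eisenstein) ^ j) ^ n * ((omega ^ j) ^ n) ^ 2)) * (π ^ 2) ^ n := by
        rw [h3, mul_one]
    _ = (u * (omega ^ j) ^ n) ^ 2 * (omega ^ j * π ^ 2) ^ n := by ring
    _ = _ := by rw [h2, one_mul]

theorem sq_eq_or_sq_eq_star {p : ℤ} (hp : Prime p) {π : Eisenstein} (hπ : π.norm = p)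
    {n j : ℕ} {z : Eisenstein} (hz : z.norm = p ^ n) (hpz : ¬ (p : Eisenstein) ∣ z)
    (hz2 : 2 ∣ z - 1) (hπ2 : 2 ∣ π - omega ^ j) :
    z ^ 2 = (omega ^ j * π ^ 2) ^ n ∨ star z ^ 2 = (omega ^ j * π ^ 2) ^ n := by
  obtain ⟨u, hu, h | h⟩ := exists_eq_unit_mul_pow hp hπ n z hz hpz
  · exact .inl (sq_eq_of_eq_unit_mul_pow hu h hz2 hπ2)
  · refine .inr (sq_eq_of_eq_unit_mul_pow (u := star u) ?_ ?_ ?_ hπ2)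
    · rw [QuadraticAlgebra.norm_star, hu]
    · rw [h, star_mul', star_pow, star_star]
    · obtain ⟨v, hv⟩ := hz2
      refine ⟨star v, ?_⟩
      simpa using congrArg star hv

end Eisenstein

lemma ne_one_of_orderOf_eq_three {F R : Type*} [Field F] [CommRing R] {ψ : MulChar F R}
    (hψ : orderOf ψ = 3) : ψ ≠ 1 := by
  rintro rfl
  simp at hψ

lemma sq_eq_inv_of_orderOf_eq_three {F R : Type*} [Field F] [CommRing R] {ψ : MulChar F R}
    (hψ : orderOf ψ = 3) : ψ ^ 2 = ψ⁻¹ := by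
  refine eq_inv_of_mul_eq_one_left ?_
  rw [← pow_succ, ← pow_orderOf_eq_one ψ, hψ]

section CharacterSums

variable {F : Type*} [Field F] [Fintype F]

/-- The number of cube roots of `v` in a finite field with a cubic character `ψ`. -/
lemma card_cube_roots [DecidableEq F] {R : Type*} [CommRing R] [IsDomain R] {ψ : MulChar F R}
    (hψ : orderOf ψ = 3) (v : F) :
    ((Finset.univ.filter fun x : F ↦ x ^ 3 = v).card : R) = 1 + ψ v + ψ v ^ 2 := by
  have hψ3 : ψ ^ 3 = 1 := hψ ▸ pow_orderOf_eq_one ψ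
  by_cases hv : v = 0
  · subst hv
    have : (Finset.univ.filter fun x : F ↦ x ^ 3 = 0) = {0} := by
      ext x; simp
    rw [this, MulChar.map_zero]
    simp
  obtain ⟨g, hg⟩ := IsCyclic.exists_generator (α := Fˣ)
  have hgψ : ψ g ≠ 1 := by
    intro h
    have : ψ = 1 := (MulChar.eq_iff hg ψ 1).2 (by simpa using h)
    rw [this, orderOf_one] at hψ
    norm_num at hψ
  have hdvd : 3 ∣ Fintype.card F - 1 := hψ ▸ MulChar.orderOf_dvd_card_sub_one F ψ
  obtain ⟨m, hm⟩ := hdvd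
  have hg0 : orderOf (g : F) = Fintype.card F - 1 := by
    rw [orderOf_units, orderOf_eq_card_of_forall_mem_zpowers hg, Nat.card_eq_fintype_card,
      Fintype.card_units]
  have hζ : IsPrimitiveRoot ((g : F) ^ m) 3 := by
    refine (IsPrimitiveRoot.orderOf (g : F)).pow ?_ (by rw [hg0, hm, mul_comm])
    rw [hg0]
    have := Fintype.one_lt_card (α := F)
    omega
  have hcard : (Finset.univ.filter fun x : F ↦ x ^ 3 = v).card =
      Multiset.card (Polynomial.nthRoots 3 v) := by
    rw [← Multiset.toFinset_card_of_nodup (hζ.nthRoots_nodup hv)]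
    congr 1
    ext x
    simp [Polynomial.mem_nthRoots]
  rw [hcard, hζ.card_nthRoots]
  have hpow (x : F) (hx : x ≠ 0) : ψ x ^ 3 = 1 := by
    rw [← MulChar.pow_apply' _ (by norm_num), hψ3, MulChar.one_apply hx.isUnit]
  split_ifs with h
  · obtain ⟨u, rfl⟩ := h
    have hu : u ≠ 0 := by rintro rfl; simp at hv
    rw [map_pow, hpow u hu]
    norm_num
  · have hv1 : ψ v ≠ 1 := by
      intro h1
      obtain ⟨k, hk⟩ := mem_powers_iff_mem_zpowers.2 (hg (Units.mk0 v hv))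
      have hkv : (g : F) ^ k = v := by simpa using congrArg Units.val hk
      have hk1 : ψ g ^ k = 1 := by rw [← map_pow, hkv, h1]
      have hord : orderOf (ψ g) = 3 := orderOf_eq_prime (hpow g g.ne_zero) hgψ
      obtain ⟨l, rfl⟩ := hord ▸ orderOf_dvd_of_pow_eq_one hk1
      exact h ⟨(g : F) ^ l, by rw [← hkv]; ring⟩
    have : (ψ v - 1) * (1 + ψ v + ψ v ^ 2) = 0 := by
      linear_combination hpow v hv
    rw [(mul_eq_zero.1 this).resolve_left (sub_ne_zero.2 hv1)]
    simp

lemma sum_comp_cube {R : Type*} [CommRing R] [IsDomain R] {ψ : MulChar F R}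
    (hψ : orderOf ψ = 3) (f : F → R) :
    ∑ x, f (x ^ 3) = ∑ v, f v * (1 + ψ v + ψ v ^ 2) := by
  classical
  rw [← Finset.sum_fiberwise (s := Finset.univ) (g := fun x : F ↦ x ^ 3)]
  refine Finset.sum_congr rfl fun v _ ↦ ?_
  rw [← card_cube_roots hψ, Finset.sum_congr rfl (g := fun _ ↦ f v), Finset.sum_const,
    nsmul_eq_mul, mul_comm]
  intro x hx
  rw [(Finset.mem_filter.1 hx).2]

/-- The quadratic character of a finite field, with values in a commutative ring. -/
noncomputable def quadraticCharIn (F R : Type*) [Field F] [Fintype F] [CommRing R] : MulChar F R :=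
  haveI := Classical.decEq F
  (quadraticChar F).ringHomComp (Int.castRingHom R)

lemma quadraticCharIn_apply [DecidableEq F] {R : Type*} [CommRing R] (x : F) :
    quadraticCharIn F R x = (quadraticChar F x : ℤ) := by
  unfold quadraticCharIn
  simp only [MulChar.ringHomComp_apply, eq_intCast]
  congr!

lemma card_square_roots [DecidableEq F] (hF : ringChar F ≠ 2) {R : Type*} [CommRing R] (v : F) :
    ((Finset.univ.filter fun x : F ↦ x ^ 2 = v).card : R) = 1 + quadraticCharIn F R v := by
  have h := congrArg (Int.cast : ℤ → R) (quadraticChar_card_sqrts hF v)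
  rw [quadraticCharIn_apply]
  push_cast at h
  rw [add_comm, ← h]
  congr 2
  ext; simp

lemma sum_comp_sq (hF : ringChar F ≠ 2) {R : Type*} [CommRing R] (f : F → R) :
    ∑ x, f (x ^ 2) = ∑ v, f v * (1 + quadraticCharIn F R v) := by
  classical
  rw [← Finset.sum_fiberwise (s := Finset.univ) (g := fun x : F ↦ x ^ 2)]
  refine Finset.sum_congr rfl fun v _ ↦ ?_
  rw [← card_square_roots hF, Finset.sum_congr rfl (g := fun _ ↦ f v), Finset.sum_const,
    nsmul_eq_mul, mul_comm]
  intro x hx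
  rw [(Finset.mem_filter.1 hx).2]

lemma quadraticCharIn_sq_apply {R : Type*} [CommRing R] {x : F} (hx : x ≠ 0) :
    quadraticCharIn F R x ^ 2 = 1 := by
  classical
  rw [quadraticCharIn_apply]
  exact_mod_cast congrArg (Int.cast : ℤ → R) (quadraticChar_sq_one hx)

lemma quadraticCharIn_inv {R : Type*} [CommRing R] :
    (quadraticCharIn F R)⁻¹ = quadraticCharIn F R := by
  refine inv_eq_of_mul_eq_one_left ?_
  ext x
  rw [MulChar.mul_apply, ← pow_two, quadraticCharIn_sq_apply x.ne_zero, MulChar.one_apply_coe]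

lemma quadraticCharIn_ne_one (hF : ringChar F ≠ 2) {R : Type*} [CommRing R] [CharZero R] :
    quadraticCharIn F R ≠ 1 := by
  classical
  obtain ⟨a, ha⟩ := quadraticChar_exists_neg_one' hF
  intro h
  have h1 := DFunLike.congr_fun h (a : F)
  rw [quadraticCharIn_apply, ha, MulChar.one_apply_coe] at h1
  have : (-1 : ℤ) = 1 := by exact_mod_cast h1
  norm_num at this

lemma sum_shift_mul {R : Type*} [CommRing R] [IsDomain R] {χ ψ : MulChar F R} (h : χ * ψ ≠ 1)
    (D : F) : ∑ v, χ (v - D) * ψ v = χ (-1) * (χ D * ψ D) * jacobiSum ψ χ := by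
  by_cases hD : D = 0
  · subst hD
    rw [MulChar.map_zero, zero_mul, mul_zero, zero_mul, ← MulChar.sum_eq_zero_of_ne_one h]
    simp
  rw [jacobiSum, Finset.mul_sum]
  refine (Fintype.sum_equiv (Equiv.mulLeft₀ D hD) _ _ fun x ↦ ?_).symm
  have hx : Equiv.mulLeft₀ D hD x = D * x := rfl
  have : D * x - D = -1 * D * (1 - x) := by ring
  rw [hx, this]
  simp only [map_mul]
  ring

lemma jacobiSum_mul_inv_left {R : Type*} [CommRing R] (ψ χ : MulChar F R) (hχ : χ⁻¹ = χ) :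
    jacobiSum (χ * ψ⁻¹) χ = χ (-1) * jacobiSum ψ χ := by
  rw [jacobiSum, jacobiSum, Finset.mul_sum]
  refine Fintype.sum_equiv (Equiv.inv F) _ _ fun x ↦ ?_
  by_cases hx : x = 0
  · simp [hx, MulChar.map_zero]
  have h1 : 1 - x = x * (-1 * (1 - x⁻¹)) := by field_simp; ring
  have h2 : χ x * χ x = 1 := by
    nth_rewrite 1 [← hχ]
    rw [← MulChar.mul_apply, inv_mul_cancel, MulChar.one_apply (Ne.isUnit hx)]
  rw [h1, MulChar.mul_apply, MulChar.inv_apply', map_mul χ x, map_mul χ (-1), Equiv.inv_apply]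
  linear_combination (ψ x⁻¹ * χ (-1) * χ (1 - x⁻¹)) * h2

lemma quadraticCharIn_mul_ne_one {R : Type*} [CommRing R] {ψ : MulChar F R}
    (hψ : orderOf ψ = 3) : quadraticCharIn F R * ψ ≠ 1 := by
  intro h
  have h1 : ψ = quadraticCharIn F R := by
    rw [eq_inv_of_mul_eq_one_right h, quadraticCharIn_inv]
  have h2 : ψ ^ 2 = 1 := by
    rw [pow_two]
    nth_rewrite 1 [h1]
    exact h
  have := hψ ▸ orderOf_dvd_of_pow_eq_one h2
  norm_num at this

lemma sum_quadraticCharIn_cube_sub (hF : ringChar F ≠ 2) {R : Type*} [CommRing R] [IsDomain R]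
    [CharZero R] {ψ : MulChar F R} (hψ : orderOf ψ = 3) (D : F) :
    ∑ x, (1 + quadraticCharIn F R (x ^ 3 - D)) = Fintype.card F +
      quadraticCharIn F R (-1) * (quadraticCharIn F R D * ψ D) *
        jacobiSum ψ (quadraticCharIn F R) +
      quadraticCharIn F R (-1) * (quadraticCharIn F R D * ψ⁻¹ D) *
        jacobiSum ψ⁻¹ (quadraticCharIn F R) := by
  have hψ' : orderOf ψ⁻¹ = 3 := by rw [orderOf_inv, hψ]
  rw [sum_comp_cube hψ (fun v ↦ 1 + quadraticCharIn F R (v - D)),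
    ← sum_shift_mul (quadraticCharIn_mul_ne_one hψ) D,
    ← sum_shift_mul (quadraticCharIn_mul_ne_one hψ') D]
  have h1 : ∑ v, ψ v = 0 := MulChar.sum_eq_zero_of_ne_one (ne_one_of_orderOf_eq_three hψ)
  have h2 : ∑ v, ψ⁻¹ v = 0 := MulChar.sum_eq_zero_of_ne_one (ne_one_of_orderOf_eq_three hψ')
  have h3 : ∑ v, quadraticCharIn F R (v - D) = 0 := by
    rw [← MulChar.sum_eq_zero_of_ne_one (quadraticCharIn_ne_one (F := F) hF (R := R))]
    exact Fintype.sum_equiv (Equiv.subRight D) _ _ fun _ ↦ rfl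
  have h4 : ∑ v : F, (1 : R) = Fintype.card F := by simp
  rw [← h4, ← add_zero (∑ v : F, (1 : R)), ← h1, ← add_zero (_ + _), ← h2, ← add_zero (_ + _),
    ← h3]
  simp only [← Finset.sum_add_distrib]
  refine Finset.sum_congr rfl fun v _ ↦ ?_
  rw [← MulChar.pow_apply' ψ two_ne_zero, sq_eq_inv_of_orderOf_eq_three hψ]
  ring

lemma sum_quadraticCharIn_mul_discriminant (hF : ringChar F ≠ 2) {R : Type*} [CommRing R]
    [IsDomain R] {ψ : MulChar F R} (hψ : orderOf ψ = 3) :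
    ∑ t, quadraticCharIn F R (t ^ 4 * (t ^ 2 - 1) ^ 3) * ψ (t ^ 4 * (t ^ 2 - 1) ^ 3) =
      quadraticCharIn F R (-1) * (jacobiSum ψ⁻¹ (quadraticCharIn F R) +
        quadraticCharIn F R (-1) * jacobiSum ψ (quadraticCharIn F R)) := by
  have hψ' : orderOf ψ⁻¹ = 3 := by rw [orderOf_inv, hψ]
  set χ := quadraticCharIn F R with hχ
  have hχ2 : χ * χ = 1 := by
    nth_rewrite 1 [hχ, ← quadraticCharIn_inv]
    rw [inv_mul_cancel]
  have hψ3 (u : F) (hu : u ≠ 0) : ψ u ^ 3 = 1 := by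
    rw [← MulChar.pow_apply' _ (by norm_num), ← hψ, pow_orderOf_eq_one,
      MulChar.one_apply hu.isUnit]
  have h (t : F) : χ (t ^ 4 * (t ^ 2 - 1) ^ 3) * ψ (t ^ 4 * (t ^ 2 - 1) ^ 3) =
      χ (t ^ 2 - 1) * ψ⁻¹ (t ^ 2) := by
    rw [← sq_eq_inv_of_orderOf_eq_three hψ, MulChar.pow_apply' _ two_ne_zero]
    simp only [map_mul, map_pow]
    by_cases ht : t = 0
    · simp [ht, MulChar.map_zero]
    by_cases hu : t ^ 2 - 1 = 0
    · simp [hu, MulChar.map_zero]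
    have e1 : χ t ^ 2 = 1 := quadraticCharIn_sq_apply ht
    have e2 : χ (t ^ 2 - 1) ^ 2 = 1 := quadraticCharIn_sq_apply hu
    calc _ = (χ t ^ 2) ^ 2 * χ (t ^ 2 - 1) ^ 2 * ψ (t ^ 2 - 1) ^ 3 *
          (χ (t ^ 2 - 1) * (ψ t ^ 2) ^ 2) := by ring
      _ = _ := by rw [e1, e2, hψ3 _ hu]; ring
  rw [Finset.sum_congr rfl fun t _ ↦ h t, sum_comp_sq hF fun s ↦ χ (s - 1) * ψ⁻¹ s]
  have key := sum_shift_mul (quadraticCharIn_mul_ne_one hψ') 1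
  have key' := sum_shift_mul (χ := χ) (ψ := χ * ψ⁻¹) (by
    rw [← mul_assoc, hχ2, one_mul]
    exact ne_one_of_orderOf_eq_three hψ') 1
  rw [jacobiSum_mul_inv_left _ _ quadraticCharIn_inv] at key'
  simp only [map_one, mul_one] at key key'
  rw [mul_add, ← key, ← key', ← Finset.sum_add_distrib]
  refine Finset.sum_congr rfl fun s _ ↦ ?_
  rw [MulChar.mul_apply]
  ring

lemma jacobiSum_mul_jacobiSum_quadraticCharIn (hF : ringChar F ≠ 2) {R : Type*} [Field R]
    [CharZero R] {ψ : MulChar F R} (hψ : orderOf ψ = 3) :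
    jacobiSum ψ (quadraticCharIn F R) * jacobiSum ψ⁻¹ (quadraticCharIn F R) =
      Fintype.card F := by
  nth_rewrite 2 [← quadraticCharIn_inv]
  refine jacobiSum_mul_jacobiSum_inv ?_ (ne_one_of_orderOf_eq_three hψ)
    (quadraticCharIn_ne_one hF) (by rw [mul_comm]; exact quadraticCharIn_mul_ne_one hψ)
  rw [ringChar.eq_zero]
  exact (CharP.ringChar_ne_zero_of_finite F).symm

/-- The number of points of `y ^ 2 = x ^ 3 - t ^ 4 * (t ^ 2 - 1) ^ 3` in terms of the Jacobi sums
of the quadratic character and a cubic character. -/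
theorem card_solutions_eq_jacobiSum (hF : ringChar F ≠ 2) {R : Type*} [Field R] [CharZero R]
    {ψ : MulChar F R} (hψ : orderOf ψ = 3) :
    (Nat.card {v : F × F × F // v.2.2 ^ 2 = v.2.1 ^ 3 - v.1 ^ 4 * (v.1 ^ 2 - 1) ^ 3} : R) =
      Fintype.card F ^ 2 + 2 * Fintype.card F +
        quadraticCharIn F R (-1) * (jacobiSum ψ (quadraticCharIn F R) ^ 2 +
          jacobiSum ψ⁻¹ (quadraticCharIn F R) ^ 2) := by
  classical
  have hψ' : orderOf ψ⁻¹ = 3 := by rw [orderOf_inv, hψ]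
  have hcount : (Nat.card {v : F × F × F //
      v.2.2 ^ 2 = v.2.1 ^ 3 - v.1 ^ 4 * (v.1 ^ 2 - 1) ^ 3} : R) =
      ∑ t : F, ∑ x : F, (1 + quadraticCharIn F R (x ^ 3 - t ^ 4 * (t ^ 2 - 1) ^ 3)) := by
    simp only [← card_square_roots hF]
    rw [Nat.card_eq_fintype_card, Fintype.card_subtype, Finset.card_filter, Fintype.sum_prod_type]
    push_cast
    refine Finset.sum_congr rfl fun t _ ↦ ?_
    rw [Fintype.sum_prod_type]
    refine Finset.sum_congr rfl fun x _ ↦ ?_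
    rw [Finset.card_filter]
    push_cast
    rfl
  rw [hcount, Finset.sum_congr rfl fun t _ ↦ sum_quadraticCharIn_cube_sub hF hψ _,
    Finset.sum_add_distrib, Finset.sum_add_distrib, ← Finset.sum_mul, ← Finset.sum_mul,
    ← Finset.mul_sum, ← Finset.mul_sum, sum_quadraticCharIn_mul_discriminant hF hψ,
    sum_quadraticCharIn_mul_discriminant hF hψ', inv_inv, Finset.sum_const, Finset.card_univ,
    nsmul_eq_mul]
  have hJ := jacobiSum_mul_jacobiSum_quadraticCharIn (F := F) hF hψ
  have h1 : quadraticCharIn F R (-1) ^ 2 = 1 := quadraticCharIn_sq_apply (by simp)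
  linear_combination (2 * quadraticCharIn F R (-1) ^ 2) * hJ + (2 * Fintype.card F +
    quadraticCharIn F R (-1) * (jacobiSum ψ (quadraticCharIn F R) ^ 2 +
          jacobiSum ψ⁻¹ (quadraticCharIn F R) ^ 2)) * h1

/-- The value at `-1` of the quadratic character of a field with `p ^ n` elements. -/
lemma quadraticCharIn_neg_one {R : Type*} [CommRing R] {p n : ℕ} (hp : p % 2 = 1)
    (hF : Fintype.card F = p ^ n) :
    quadraticCharIn F R (-1) = ((-1) ^ (p / 2)) ^ n := by
  classical
  have hchar : ringChar F ≠ 2 := by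
    intro h
    have h1 := FiniteField.even_card_of_char_two h
    rw [hF] at h1
    have := (Nat.odd_iff.2 hp).pow (n := n)
    rw [Nat.odd_iff] at this
    omega
  rw [quadraticCharIn_apply, quadraticChar_neg_one hchar, hF]
  push_cast
  rw [map_pow, ZMod.χ₄_eq_neg_one_pow hp]
  push_cast
  rfl

lemma two_dvd_jacobiSum_sub_one {R : Type*} [CommRing R] [IsDomain R] {ψ : MulChar F R}
    (hψ : ψ ≠ 1) : 2 ∣ jacobiSum ψ (quadraticCharIn F R) - 1 := by
  classical
  have h : jacobiSum ψ (quadraticCharIn F R) - 1 =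
      ∑ x, ψ x * (quadraticCharIn F R (1 - x) - 1 + if x = 1 then 1 else 0) - 2 := by
    simp only [mul_add, mul_sub, Finset.sum_add_distrib, Finset.sum_sub_distrib, mul_one,
      MulChar.sum_eq_zero_of_ne_one hψ, jacobiSum]
    simp
    ring
  rw [h]
  refine dvd_sub (Finset.dvd_sum fun x _ ↦ Dvd.dvd.mul_left ?_ _) dvd_rfl
  by_cases hx : x = 1
  · simp [hx, MulChar.map_zero]
  · rw [quadraticCharIn_apply, if_neg hx, add_zero]
    rcases quadraticChar_dichotomy (sub_ne_zero.2 (Ne.symm hx)) with h | h <;> rw [h]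
    · simp
    · exact ⟨-1, by norm_num⟩

lemma sum_pow_card_sub_one : ∑ x : F, x ^ (Fintype.card F - 1) = -1 := by
  classical
  have hq := Fintype.one_lt_card (α := F)
  have h (x : F) : x ^ (Fintype.card F - 1) = 1 - if x = 0 then 1 else 0 := by
    split_ifs with hx
    · rw [hx, zero_pow (by omega), sub_self]
    · rw [FiniteField.pow_card_sub_one_eq_one x hx, sub_zero]
  simp [h]

lemma sum_pow_of_lt_of_ne {i : ℕ} (hi : i < 2 * (Fintype.card F - 1))
    (hi' : i ≠ Fintype.card F - 1) : ∑ x : F, x ^ i = 0 := by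
  have hq := Fintype.one_lt_card (α := F)
  rcases hi'.lt_or_gt with h | h
  · exact FiniteField.sum_pow_lt_card_sub_one F i h
  · rw [← FiniteField.sum_pow_lt_card_sub_one F (i - (Fintype.card F - 1)) (by omega)]
    refine Finset.sum_congr rfl fun x _ ↦ ?_
    obtain ⟨k, hk⟩ := Nat.exists_eq_add_of_lt h
    have e1 : i = Fintype.card F + k := by omega
    have e2 : i - (Fintype.card F - 1) = k + 1 := by omega
    rw [e2, e1, pow_add, FiniteField.pow_card, pow_succ']

lemma sum_one_sub_cube_pow {m k : ℕ} (hm : 2 * m + 1 = Fintype.card F)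
    (hk : 3 * k + 1 = Fintype.card F) :
    ∑ x : F, (1 - x ^ 3) ^ m = -((-1 : F) ^ k * m.choose k) := by
  have hq := Fintype.one_lt_card (α := F)
  have h (x : F) : (1 - x ^ 3) ^ m =
      ∑ i ∈ Finset.range (m + 1), ((-1 : F) ^ i * m.choose i) * x ^ (3 * i) := by
    rw [sub_eq_neg_add, add_pow]
    refine Finset.sum_congr rfl fun i _ ↦ ?_
    rw [neg_pow, one_pow, pow_mul]
    ring
  simp only [h]
  rw [Finset.sum_comm, Finset.sum_eq_single k]
  · rw [← Finset.mul_sum, show 3 * k = Fintype.card F - 1 by omega, sum_pow_card_sub_one]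
    ring
  · intro i hi hik
    rw [Finset.mem_range] at hi
    rw [← Finset.mul_sum, sum_pow_of_lt_of_ne (by omega) (by omega), mul_zero]
  · intro hk'
    rw [Finset.mem_range] at hk'
    omega

end CharacterSums

lemma not_dvd_choose_half_third {p : ℕ} (hp : p.Prime) (hp6 : p % 6 = 1) (n m k : ℕ)
    (hm : 2 * m + 1 = p ^ n) (hk : 3 * k + 1 = p ^ n) : ¬ p ∣ m.choose k := by
  have := Fact.mk hp
  induction n generalizing m k with
  | zero =>
    obtain rfl : m = 0 := by simpa using hm
    obtain rfl : k = 0 := by simpa using hk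
    simpa using hp.ne_one
  | succ n ih =>
    obtain ⟨r, hr⟩ : ∃ r, p = 6 * r + 1 := ⟨p / 6, by omega⟩
    obtain ⟨s, hs⟩ : ∃ s, p ^ n = 6 * s + 1 := by
      have : p ^ n % 6 = 1 := by rw [Nat.pow_mod, hp6]; simp
      exact ⟨p ^ n / 6, by omega⟩
    have hpp := hp.pos
    have hm' : m = 3 * r + p * (3 * s) := by
      rw [pow_succ, hs] at hm
      nlinarith
    have hk' : k = 2 * r + p * (2 * s) := by
      rw [pow_succ, hs] at hk
      nlinarith
    have hmod := Choose.choose_modEq_choose_mod_mul_choose_div_nat (n := m) (k := k) (p := p)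
    rw [hm', hk', Nat.add_mul_mod_self_left, Nat.add_mul_mod_self_left,
      Nat.add_mul_div_left _ _ hpp, Nat.add_mul_div_left _ _ hpp, Nat.mod_eq_of_lt (by omega),
      Nat.mod_eq_of_lt (by omega), Nat.div_eq_of_lt (by omega), Nat.div_eq_of_lt (by omega),
      zero_add, zero_add, ← hm', ← hk'] at hmod
    rw [hmod.dvd_iff dvd_rfl, hp.dvd_mul, not_or]
    refine ⟨fun h ↦ ?_, ih _ _ (by omega) (by omega)⟩
    have h1 : p ∣ (3 * r).factorial := by
      rw [← Nat.choose_mul_factorial_mul_factorial (show 2 * r ≤ 3 * r by omega), mul_assoc]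
      exact h.mul_right _
    have := (hp.dvd_factorial).1 h1
    omega

namespace Eisenstein

open QuadraticAlgebra

/-- The embedding of the Eisenstein integers into `ℂ` given by a root `w` of `X ^ 2 + X + 1`. -/
noncomputable def toComplex (w : ℂ) (hw : w ^ 2 + w + 1 = 0) : Eisenstein →+* ℂ :=
  (QuadraticAlgebra.lift ⟨w, by simp; linear_combination hw⟩ : Eisenstein →ₐ[ℤ] ℂ).toRingHom

variable {w : ℂ} {hw : w ^ 2 + w + 1 = 0}

lemma toComplex_apply (z : Eisenstein) : toComplex w hw z = z.re + z.im * w := by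
  simp [toComplex, QuadraticAlgebra.lift]

lemma im_ne_zero (hw : w ^ 2 + w + 1 = 0) : w.im ≠ 0 := by
  intro h
  have := congrArg Complex.re hw
  simp [pow_two, h] at this
  nlinarith [sq_nonneg (w.re + 1 / 2)]

lemma conj_eq (hw : w ^ 2 + w + 1 = 0) : (starRingEnd ℂ) w = -1 - w := by
  have h := congrArg Complex.im hw
  simp [pow_two] at h
  have h2 : w.im * (2 * w.re + 1) = 0 := by linear_combination h
  have h3 := (mul_eq_zero.1 h2).resolve_left (im_ne_zero hw)
  apply Complex.ext
  · simp
    linarith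
  · simp

lemma toComplex_star (z : Eisenstein) :
    toComplex w hw (star z) = (starRingEnd ℂ) (toComplex w hw z) := by
  simp [toComplex_apply, conj_eq hw]
  ring

lemma toComplex_injective : Function.Injective (toComplex w hw) := by
  intro x y h
  rw [toComplex_apply, toComplex_apply] at h
  have him : x.im = y.im := by
    have h1 := congrArg Complex.im h
    simpa [im_ne_zero hw] using h1
  have hre : x.re = y.re := by
    rw [him] at h
    exact_mod_cast add_right_cancel h
  exact QuadraticAlgebra.ext hre him

lemma exists_cube_root : ∃ w : ℂ, w ^ 2 + w + 1 = 0 := by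
  have hdeg : (Polynomial.X ^ 2 + Polynomial.X + 1 : Polynomial ℂ).degree = 2 := by
    compute_degree!
  obtain ⟨w, hw⟩ := IsAlgClosed.exists_root _ (by rw [hdeg]; exact two_ne_zero)
  exact ⟨w, by simpa using hw⟩

instance : IsDomain Eisenstein := by
  obtain ⟨w, hw⟩ := exists_cube_root
  exact (toComplex_injective (hw := hw)).isDomain

lemma isPrimitiveRoot_omega : IsPrimitiveRoot (omega : Eisenstein) 3 := by
  refine IsPrimitiveRoot.iff_orderOf.2 (orderOf_eq_prime omega_pow_three fun h ↦ ?_)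
  have := congrArg QuadraticAlgebra.im h
  simp at this

lemma star_eq_sq_of_pow_three_eq_one {z : Eisenstein} (hz : z ^ 3 = 1) : star z = z ^ 2 := by
  have h1 : z.norm ^ 3 = 1 := by rw [← map_pow, hz, map_one]
  have h2 : z.norm = 1 := by
    have h3 : (z.norm - 1) * (z.norm ^ 2 + z.norm + 1) = 0 := by linear_combination h1
    have h4 : z.norm ^ 2 + z.norm + 1 ≠ 0 := by nlinarith [sq_nonneg (2 * z.norm + 1)]
    linarith [(mul_eq_zero.1 h3).resolve_right h4]
  have h5 := mul_star_eq z
  rw [h2, Int.cast_one] at h5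
  linear_combination z ^ 2 * h5 - star z * hz

lemma ringHomComp_inv {F R R' : Type*} [Field F] [CommRing R] [CommRing R'] (f : R →+* R')
    (χ : MulChar F R) : (χ.ringHomComp f)⁻¹ = χ⁻¹.ringHomComp f := by
  ext x
  rw [MulChar.inv_apply', MulChar.ringHomComp_apply, MulChar.ringHomComp_apply,
    MulChar.inv_apply']

lemma orderOf_ringHomComp {F : Type*} [Field F] {ψ : MulChar F Eisenstein}
    (hψ : orderOf ψ = 3) :
    orderOf (ψ.ringHomComp (toComplex w hw)) = 3 := by
  refine orderOf_eq_prime ?_ ?_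
  · rw [MulChar.ringHomComp_pow, ← hψ, pow_orderOf_eq_one, MulChar.ringHomComp_one]
  · exact (MulChar.ringHomComp_ne_one_iff toComplex_injective).2 (ne_one_of_orderOf_eq_three hψ)

section JacobiSum

variable {F : Type*} [Field F] [Fintype F] {ψ : MulChar F Eisenstein}

lemma star_jacobiSum (hψ : orderOf ψ = 3) :
    star (jacobiSum ψ (quadraticCharIn F Eisenstein)) =
      jacobiSum ψ⁻¹ (quadraticCharIn F Eisenstein) := by
  classical
  rw [jacobiSum, jacobiSum, star_sum]
  refine Finset.sum_congr rfl fun x _ ↦ ?_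
  rw [star_mul', quadraticCharIn_apply, star_intCast, ← sq_eq_inv_of_orderOf_eq_three hψ,
    MulChar.pow_apply' _ two_ne_zero]
  congr 1
  by_cases hx : x = 0
  · rw [hx, MulChar.map_zero]
    simp
  · refine star_eq_sq_of_pow_three_eq_one ?_
    rw [← MulChar.pow_apply' _ three_ne_zero, ← hψ, pow_orderOf_eq_one,
      MulChar.one_apply (Ne.isUnit hx)]

lemma ringHomComp_quadraticCharIn {R R' : Type*} [CommRing R] [CommRing R'] (f : R →+* R') :
    (quadraticCharIn F R).ringHomComp f = quadraticCharIn F R' := by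
  classical
  ext x
  rw [MulChar.ringHomComp_apply, quadraticCharIn_apply, quadraticCharIn_apply, map_intCast]

lemma norm_jacobiSum (hF : ringChar F ≠ 2) (hψ : orderOf ψ = 3) :
    (jacobiSum ψ (quadraticCharIn F Eisenstein)).norm = Fintype.card F := by
  obtain ⟨w, hw⟩ := exists_cube_root
  have h := jacobiSum_mul_jacobiSum_quadraticCharIn hF (R := ℂ)
    (orderOf_ringHomComp (hw := hw) hψ)
  rw [ringHomComp_inv, ← ringHomComp_quadraticCharIn (toComplex w hw), jacobiSum_ringHomComp,
    jacobiSum_ringHomComp, ← map_mul, ← star_jacobiSum hψ, mul_star_eq, map_intCast] at h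
  exact_mod_cast h

lemma jacobiSum_add_star (hψ : orderOf ψ = 3) (hF : ringChar F ≠ 2) [DecidableEq F] :
    jacobiSum ψ (quadraticCharIn F Eisenstein) +
      star (jacobiSum ψ (quadraticCharIn F Eisenstein)) =
        (∑ x : F, quadraticChar F (1 - x ^ 3) : ℤ) := by
  have h0 : ∑ v, quadraticCharIn F Eisenstein (1 - v) = 0 := by
    rw [← MulChar.sum_eq_zero_of_ne_one (quadraticCharIn_ne_one (F := F) hF (R := Eisenstein))]
    exact Fintype.sum_equiv (Equiv.subLeft 1) _ _ fun _ ↦ rfl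
  push_cast
  simp only [← quadraticCharIn_apply]
  rw [sum_comp_cube hψ fun v ↦ quadraticCharIn F Eisenstein (1 - v), star_jacobiSum hψ]
  simp only [mul_add, mul_one, Finset.sum_add_distrib, h0, zero_add]
  simp only [← MulChar.pow_apply' ψ two_ne_zero, sq_eq_inv_of_orderOf_eq_three hψ, jacobiSum,
    mul_comm]

lemma not_dvd_jacobiSum {p n : ℕ} (hp : p.Prime) (hp6 : p % 6 = 1)
    (hF : Fintype.card F = p ^ n) (hF2 : ringChar F ≠ 2) [CharP F p] (hψ : orderOf ψ = 3) :
    ¬ (p : Eisenstein) ∣ jacobiSum ψ (quadraticCharIn F Eisenstein) := by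
  classical
  rintro ⟨v, hv⟩
  have h := jacobiSum_add_star hψ hF2
  rw [hv, star_mul', star_natCast, ← mul_add] at h
  have hdvd : (p : ℤ) ∣ ∑ x : F, quadraticChar F (1 - x ^ 3) := by
    refine ⟨(v + star v).re, ?_⟩
    have h1 := congrArg QuadraticAlgebra.re h
    rw [re_intCast, Int.cast_id] at h1
    rw [← h1]
    simp
  rw [← CharP.intCast_eq_zero_iff F p] at hdvd
  obtain ⟨s, hs⟩ : ∃ s, p ^ n = 6 * s + 1 := by
    have : p ^ n % 6 = 1 := by rw [Nat.pow_mod, hp6]; simp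
    exact ⟨p ^ n / 6, by omega⟩
  push_cast at hdvd
  simp only [quadraticChar_eq_pow_of_char_ne_two' hF2] at hdvd
  rw [show Fintype.card F / 2 = 3 * s by omega,
    sum_one_sub_cube_pow (k := 2 * s) (by omega) (by omega)] at hdvd
  have hc : ((3 * s).choose (2 * s) : F) = 0 := by simpa using hdvd
  rw [CharP.cast_eq_zero_iff F p] at hc
  exact not_dvd_choose_half_third hp hp6 n _ _ (by omega) (by omega) hc

end JacobiSum

end Eisenstein

/-- For a prime `p ≥ 5` with `p ≡ 1 (mod 3)`, writing `p = a² - ab + b²` and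
normalizing `a + bω ≡ ω^j (mod 2ℤ[ω])`, the number of solutions `(t,x,y) ∈ F³` of
`y² = x³ - t⁴(t²-1)³` over a field `F` with `pⁿ` elements equals
`p^{2n} + 2pⁿ + αⁿ + conj(α)ⁿ`, where `α = (-1)^{(p-1)/2}·ω^j·(a+bω)²`. -/
theorem stmt_16 (p : ℕ) (hp : p.Prime) (hp5 : 5 ≤ p) (hp3 : p % 3 = 1)
    (n : ℕ) (hn : 0 < n)
    (F : Type*) [Field F] [Fintype F] (hF : Fintype.card F = p ^ n)
    (ω : ℂ) (hω : ω = (-1 + Complex.I * (Real.sqrt 3 : ℝ)) / 2)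
    (a b : ℤ) (hab : (p : ℤ) = a ^ 2 - a * b + b ^ 2)
    (j : ℕ) (hj : j ≤ 2)
    (hnorm : ∃ c d : ℤ, (a : ℂ) + (b : ℂ) * ω - ω ^ j = 2 * ((c : ℂ) + (d : ℂ) * ω))
    (α : ℂ) (hα : α = (-1 : ℂ) ^ ((p - 1) / 2) * ω ^ j * ((a : ℂ) + (b : ℂ) * ω) ^ 2) :
    (Nat.card {v : F × F × F //
        v.2.2 ^ 2 = v.2.1 ^ 3 - v.1 ^ 4 * (v.1 ^ 2 - 1) ^ 3} : ℂ) =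
      (p : ℂ) ^ (2 * n) + 2 * (p : ℂ) ^ n + α ^ n + (starRingEnd ℂ) α ^ n := by
  have hp6 : p % 6 = 1 := by
    rcases hp.eq_two_or_odd with h | h <;> omega
  have hchar : CharP F p := by
    have := Fact.mk hp
    exact charP_of_card_eq_prime_pow hF
  have hF2 : ringChar F ≠ 2 := by
    rw [ringChar.eq F p]
    omega
  have hw : ω ^ 2 + ω + 1 = 0 := by
    have h3 : ((Real.sqrt 3 : ℝ) : ℂ) ^ 2 = 3 := by
      exact_mod_cast Real.sq_sqrt (show (0 : ℝ) ≤ 3 by norm_num)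
    rw [hω]
    linear_combination (Complex.I ^ 2 / 4) * h3 + 3 / 4 * Complex.I_sq
  obtain ⟨s, hs⟩ : ∃ s, p ^ n = 6 * s + 1 := by
    have : p ^ n % 6 = 1 := by rw [Nat.pow_mod, hp6]; simp
    exact ⟨p ^ n / 6, by omega⟩
  obtain ⟨ψ, hψ⟩ := MulChar.exists_mulChar_orderOf F (n := 3)
    (by rw [hF, hs]; omega) Eisenstein.isPrimitiveRoot_omega
  set ι := Eisenstein.toComplex ω hw with hι
  set J := jacobiSum ψ (quadraticCharIn F Eisenstein) with hJ
  have hcount := card_solutions_eq_jacobiSum hF2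
    (Eisenstein.orderOf_ringHomComp (hw := hw) hψ)
  rw [Eisenstein.ringHomComp_inv, ← hι,
    ← Eisenstein.ringHomComp_quadraticCharIn (F := F) ι, jacobiSum_ringHomComp,
    jacobiSum_ringHomComp, ← Eisenstein.star_jacobiSum hψ, ← hJ,
    Eisenstein.ringHomComp_quadraticCharIn, quadraticCharIn_neg_one (by omega) hF,
    show p / 2 = (p - 1) / 2 by omega, hF] at hcount
  set π : Eisenstein := ⟨a, b⟩ with hπ
  have hιπ : ι π = a + b * ω := Eisenstein.toComplex_apply π
  have hιω : ι QuadraticAlgebra.omega = ω := by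
    rw [hι, Eisenstein.toComplex_apply]
    simp
  have hπ2 : 2 ∣ π - QuadraticAlgebra.omega ^ j := by
    obtain ⟨c, d, hcd⟩ := hnorm
    refine ⟨⟨c, d⟩, Eisenstein.toComplex_injective (hw := hw) ?_⟩
    rw [← hι, map_sub, map_mul, map_pow, hιπ, hιω, hcd, map_ofNat, hι,
      Eisenstein.toComplex_apply]
  have hmain := Eisenstein.sq_eq_or_sq_eq_star (p := p) (Nat.prime_iff_prime_int.1 hp) (π := π)
    (by rw [Eisenstein.norm_eq, hab]) (n := n) (j := j) (z := J)
    (by rw [Eisenstein.norm_jacobiSum hF2 hψ, hF]; push_cast; rfl)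
    (by simpa using Eisenstein.not_dvd_jacobiSum hp hp6 hF hF2 hψ)
    (two_dvd_jacobiSum_sub_one (ne_one_of_orderOf_eq_three hψ)) hπ2
  have hαι : α = (-1) ^ ((p - 1) / 2) * ι (QuadraticAlgebra.omega ^ j * π ^ 2) := by
    rw [hα, map_mul, map_pow, map_pow, hιπ, hιω, mul_assoc]
  have hα1 : α ^ n = ((-1) ^ ((p - 1) / 2)) ^ n *
      ι ((QuadraticAlgebra.omega ^ j * π ^ 2) ^ n) := by
    rw [hαι, mul_pow, map_pow ι]
  have hα2 : (starRingEnd ℂ) α ^ n = ((-1) ^ ((p - 1) / 2)) ^ n *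
      ι (star ((QuadraticAlgebra.omega ^ j * π ^ 2) ^ n)) := by
    rw [hι, Eisenstein.toComplex_star, ← hι, ← map_pow, hα1]
    simp
  rw [hcount, hα1, hα2]
  push_cast
  rcases hmain with h | h
  · rw [← h, star_pow, map_pow, map_pow]
    ring
  · rw [← h, star_pow, star_star, map_pow, map_pow]
    ring
end
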